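/- Let d ≥ 1, let ρ be a density matrix on ℂ^d, let ε ∈ (0,1), and let E(X) = Σ_j K_j X K_j† be a channel on d×d matrices (Σ_j K_j† K_j = I) such that E(σ) is diagonal for every diagonal density matrix σ (a maximally incoherent operation, MIO). Define C^ε_min(ρ) := sSup{ sInf{ −log₂ Tr(Aσ) | σ a diagonal density matrix on ℂ^d } | A a d×d matrix with 0 ≤ A ≤ I in the Loewner order and Tr(Aρ) ≥ 1 − ε }. Then C^ε_min(E(ρ)) ≤ C^ε_min(ρ). (Monotonicity of the smooth min-relative entropy of coherence under MIO.) -/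

import Mathlib

open Matrix ComplexOrder

/-- The ε-smooth min-relative entropy of coherence
`C^ε_min(ρ) = max_{0 ≤ A ≤ I, Tr(Aρ) ≥ 1−ε} min_{σ incoherent} −log₂ Tr(Aσ)`. -/
noncomputable def CminSmooth (d : ℕ) (ε : ℝ) (ρ : Matrix (Fin d) (Fin d) ℂ) : ℝ :=
  sSup {y : ℝ | ∃ A : Matrix (Fin d) (Fin d) ℂ,
    A.PosSemidef ∧ (1 - A).PosSemidef ∧ 1 - ε ≤ (A * ρ).trace.re ∧
    y = sInf {z : ℝ | ∃ σ : Matrix (Fin d) (Fin d) ℂ,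
      σ.PosSemidef ∧ σ.trace = 1 ∧ σ.IsDiag ∧
      z = -Real.logb 2 ((A * σ).trace.re)}}

/-- The infimum of `−log₂ Tr(Aσ)` over incoherent density matrices `σ`. -/
noncomputable def incoherentMinLog {d : ℕ} (A : Matrix (Fin d) (Fin d) ℂ) : ℝ :=
  sInf {z : ℝ | ∃ σ : Matrix (Fin d) (Fin d) ℂ,
      σ.PosSemidef ∧ σ.trace = 1 ∧ σ.IsDiag ∧
      z = -Real.logb 2 ((A * σ).trace.re)}

section Trace

variable {m : Type*} [Fintype m]

theorem Matrix.IsDiag.trace_mul {R : Type*} [NonUnitalNonAssocSemiring R] {σ : Matrix m m R}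
    (hσ : σ.IsDiag) (A : Matrix m m R) : (A * σ).trace = ∑ i, A i i * σ i i := by
  simp only [trace, diag_apply, mul_apply]
  refine Finset.sum_congr rfl fun i _ ↦ Finset.sum_eq_single i (fun j _ hj ↦ ?_) (by simp)
  rw [hσ hj, mul_zero]

theorem trace_mul_sum_kraus {ι : Type*} [Fintype ι] (K : ι → Matrix m m ℂ) (A X : Matrix m m ℂ) :
    (A * ∑ j, K j * X * (K j)ᴴ).trace = ((∑ j, (K j)ᴴ * A * K j) * X).trace := by
  rw [Matrix.mul_sum, Matrix.sum_mul, trace_sum, trace_sum]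
  refine Finset.sum_congr rfl fun j _ ↦ ?_
  rw [← Matrix.mul_assoc, ← Matrix.mul_assoc, trace_mul_comm, ← Matrix.mul_assoc,
    ← Matrix.mul_assoc]

variable [DecidableEq m]

theorem Matrix.PosSemidef.exists_eq_conjTranspose_mul_self {A : Matrix m m ℂ}
    (hA : A.PosSemidef) : ∃ C : Matrix m m ℂ, A = Cᴴ * C := by
  open scoped MatrixOrder in
  exact CStarAlgebra.nonneg_iff_eq_star_mul_self.mp (nonneg_iff_posSemidef.mpr hA)

theorem Matrix.PosSemidef.trace_mul_re_nonneg {A B : Matrix m m ℂ}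
    (hA : A.PosSemidef) (hB : B.PosSemidef) : 0 ≤ (A * B).trace.re := by
  obtain ⟨C, rfl⟩ := hB.exists_eq_conjTranspose_mul_self
  rw [← Matrix.mul_assoc, Matrix.trace_mul_comm, ← Matrix.mul_assoc]
  exact (Complex.le_def.mp (hA.mul_mul_conjTranspose_same C).trace_nonneg).1

theorem Matrix.PosSemidef.one_sub_of_trace_eq_one {ρ : Matrix m m ℂ}
    (hρ : ρ.PosSemidef) (htr : ρ.trace = 1) : (1 - ρ).PosSemidef := by
  have hsum : ∑ i, hρ.1.eigenvalues i = 1 := by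
    have h := hρ.1.trace_eq_sum_eigenvalues
    rw [htr] at h
    exact Complex.ofReal_injective (by simpa using h.symm)
  have hle : ∀ i, hρ.1.eigenvalues i ≤ 1 := fun i ↦ hsum ▸
    Finset.single_le_sum (fun j _ ↦ hρ.eigenvalues_nonneg j) (Finset.mem_univ i)
  set U := hρ.1.eigenvectorUnitary
  have hU : (U : Matrix m m ℂ) * (U : Matrix m m ℂ)ᴴ = 1 := Unitary.coe_mul_star_self U
  have key : 1 - ρ = (U : Matrix m m ℂ) *
      diagonal (fun i ↦ 1 - (hρ.1.eigenvalues i : ℂ)) * (U : Matrix m m ℂ)ᴴ := by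
    have hdiag : diagonal (fun i ↦ 1 - (hρ.1.eigenvalues i : ℂ)) =
        1 - diagonal (RCLike.ofReal ∘ hρ.1.eigenvalues) := by
      rw [← diagonal_one, diagonal_sub]
      rfl
    rw [hdiag, Matrix.mul_sub, Matrix.sub_mul, Matrix.mul_one, hU]
    congr 1
    conv_lhs => rw [hρ.1.spectral_theorem]
    rfl
  rw [key]
  refine PosSemidef.mul_mul_conjTranspose_same (.diagonal fun i ↦ ?_) _
  have := hle i
  simp only [Pi.zero_apply, sub_nonneg]
  exact_mod_cast this

theorem Matrix.PosSemidef.trace_mul_re_le_trace {A ρ : Matrix m m ℂ} (hA : A.PosSemidef)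
    (hρ : ρ.PosSemidef) (htr : ρ.trace = 1) : (A * ρ).trace.re ≤ A.trace.re := by
  have h := hA.trace_mul_re_nonneg (hρ.one_sub_of_trace_eq_one htr)
  rw [Matrix.mul_sub, Matrix.mul_one, trace_sub, Complex.sub_re] at h
  linarith

theorem Matrix.PosSemidef.trace_mul_re_le_one {A σ : Matrix m m ℂ} (hA : (1 - A).PosSemidef)
    (hσ : σ.PosSemidef) (htr : σ.trace = 1) : (A * σ).trace.re ≤ 1 := by
  have h := hA.trace_mul_re_nonneg hσ
  rw [Matrix.sub_mul, Matrix.one_mul, trace_sub, htr, Complex.sub_re, Complex.one_re] at h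
  linarith

theorem Matrix.PosSemidef.apply_eq_zero_of_diag_eq_zero {A : Matrix m m ℂ} (hA : A.PosSemidef)
    {j : m} (hj : A j j = 0) (i : m) : A i j = 0 := by
  have h := (hA.dotProduct_mulVec_zero_iff (Pi.single j 1)).mp (by simp [hj])
  simpa using congrFun h i

/-- An effect with diagonal bounded by `t ≤ 1` is dominated by an effect whose diagonal is
positive and still bounded by `t`. -/
theorem Matrix.PosSemidef.exists_diag_pos_extension {B : Matrix m m ℂ} (hB : B.PosSemidef)
    (hB1 : (1 - B).PosSemidef) {t : ℝ} (ht0 : 0 < t) (ht1 : t ≤ 1)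
    (hBt : ∀ i, (B i i).re ≤ t) :
    ∃ B' : Matrix m m ℂ, B'.PosSemidef ∧ (1 - B').PosSemidef ∧ (B' - B).PosSemidef ∧
      ∀ i, 0 < (B' i i).re ∧ (B' i i).re ≤ t := by
  set p : m → ℂ := fun i ↦ if B i i = 0 then 1 else 0 with hp
  have hp0 : 0 ≤ p := fun i ↦ by
    simp only [hp]; split_ifs <;> simp
  have hP : (diagonal p).PosSemidef := .diagonal hp0
  have ht0' : (0 : ℂ) ≤ t := by exact_mod_cast ht0.le
  have ht1' : (0 : ℂ) ≤ 1 - t := by rw [sub_nonneg]; exact_mod_cast ht1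
  have hBP : B * diagonal p = 0 := by
    ext i j
    by_cases hj : B j j = 0
    · simp [mul_diagonal, hB.apply_eq_zero_of_diag_eq_zero hj i]
    · simp [mul_diagonal, hp, hj]
  have hPB : diagonal p * B = 0 := by
    have := congrArg Matrix.conjTranspose hBP
    rwa [conjTranspose_mul, hB.1.eq, hP.1.eq, conjTranspose_zero] at this
  have hPP : diagonal p * diagonal p = diagonal p := by
    rw [diagonal_mul_diagonal]
    congr 1; ext i; simp [hp]
  refine ⟨B + (t : ℂ) • diagonal p, hB.add (hP.smul ht0'), ?_, ?_, fun i ↦ ?_⟩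
  · have h : 1 - (B + (t : ℂ) • diagonal p) =
        (1 - diagonal p)ᴴ * (1 - B) * (1 - diagonal p) + (1 - (t : ℂ)) • diagonal p := by
      rw [conjTranspose_sub, conjTranspose_one, hP.1.eq]
      have : (1 - diagonal p) * (1 - B) * (1 - diagonal p) = 1 - diagonal p - B := by
        simp only [Matrix.mul_sub, Matrix.sub_mul, Matrix.mul_one, Matrix.one_mul, hPB, hBP, hPP,
          Matrix.zero_mul]
        abel
      rw [this, sub_smul, one_smul]
      abel
    rw [h]
    exact (hB1.conjTranspose_mul_mul_same _).add (hP.smul ht1')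
  · simpa using hP.smul ht0'
  · by_cases hi : B i i = 0
    · simp [hp, hi, ht0]
    · have h0 := Complex.le_def.mp (hB.diag_nonneg (i := i))
      have hne : (B i i).re ≠ 0 := fun h ↦ hi (Complex.ext h h0.2.symm)
      have : (0 : ℝ) ≤ (B i i).re := h0.1
      simp only [hp, hi, add_apply, smul_apply, diagonal_apply_eq, if_false, smul_zero, add_zero]
      exact ⟨lt_of_le_of_ne this hne.symm, hBt i⟩

end Trace

section Incoherent

variable {d : ℕ}

theorem zero_mem_lowerBounds_neg_logb_trace {A : Matrix (Fin d) (Fin d) ℂ} (hA : A.PosSemidef)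
    (hA1 : (1 - A).PosSemidef) :
    (0 : ℝ) ∈ lowerBounds {z : ℝ | ∃ σ : Matrix (Fin d) (Fin d) ℂ,
      σ.PosSemidef ∧ σ.trace = 1 ∧ σ.IsDiag ∧ z = -Real.logb 2 ((A * σ).trace.re)} := by
  rintro z ⟨σ, hσ, htr, -, rfl⟩
  exact neg_nonneg.mpr <| Real.logb_nonpos one_lt_two (hA.trace_mul_re_nonneg hσ)
    (PosSemidef.trace_mul_re_le_one hA1 hσ htr)

theorem incoherentMinLog_nonneg {A : Matrix (Fin d) (Fin d) ℂ} (hA : A.PosSemidef)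
    (hA1 : (1 - A).PosSemidef) : 0 ≤ incoherentMinLog A :=
  Real.sInf_nonneg (zero_mem_lowerBounds_neg_logb_trace hA hA1)

theorem incoherentMinLog_le {A σ : Matrix (Fin d) (Fin d) ℂ} (hA : A.PosSemidef)
    (hA1 : (1 - A).PosSemidef) (hσ : σ.PosSemidef) (htr : σ.trace = 1) (hd : σ.IsDiag) :
    incoherentMinLog A ≤ -Real.logb 2 ((A * σ).trace.re) :=
  csInf_le ⟨0, zero_mem_lowerBounds_neg_logb_trace hA hA1⟩ ⟨σ, hσ, htr, hd, rfl⟩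

theorem posSemidef_diagonal_single (i : Fin d) :
    (diagonal (Pi.single i (1 : ℂ))).PosSemidef :=
  .diagonal (Pi.single_nonneg.mpr zero_le_one)

theorem trace_diagonal_single (i : Fin d) : (diagonal (Pi.single i (1 : ℂ))).trace = 1 := by
  simp [trace_diagonal]

theorem trace_mul_diagonal_single (A : Matrix (Fin d) (Fin d) ℂ) (i : Fin d) :
    (A * diagonal (Pi.single i (1 : ℂ))).trace = A i i := by
  rw [(isDiag_diagonal _).trace_mul]
  simp [Pi.single_apply]

theorem trace_mul_re_le_rpow_of_isDiag {A σ : Matrix (Fin d) (Fin d) ℂ} (hA : A.PosSemidef)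
    (hA1 : (1 - A).PosSemidef) (hσ : σ.PosSemidef) (htr : σ.trace = 1) (hd : σ.IsDiag) :
    (A * σ).trace.re ≤ 2 ^ (-incoherentMinLog A) := by
  rcases (hA.trace_mul_re_nonneg hσ).eq_or_lt with h | h
  · rw [← h]; positivity
  · rw [← Real.logb_le_iff_le_rpow one_lt_two h]
    linarith [incoherentMinLog_le hA hA1 hσ htr hd]

theorem le_incoherentMinLog (hd : 1 ≤ d) {B : Matrix (Fin d) (Fin d) ℂ} {c : ℝ}
    (hB : ∀ i, 0 < (B i i).re ∧ (B i i).re ≤ 2 ^ (-c)) : c ≤ incoherentMinLog B := by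
  refine le_csInf ⟨_, diagonal (Pi.single ⟨0, hd⟩ 1), posSemidef_diagonal_single _,
    trace_diagonal_single _, isDiag_diagonal _, rfl⟩ ?_
  rintro z ⟨σ, hσ, htr, hdiag, rfl⟩
  have him : ∀ i, (σ i i).im = 0 := fun i ↦ (Complex.le_def.mp (hσ.diag_nonneg (i := i))).2.symm
  have hre : ∀ i, 0 ≤ (σ i i).re := fun i ↦ (Complex.le_def.mp (hσ.diag_nonneg (i := i))).1
  have hsum : ∑ i, (σ i i).re = 1 := by
    have h := congrArg Complex.re htr
    simpa [trace] using h
  have htrace : (B * σ).trace.re = ∑ i, (B i i).re * (σ i i).re := by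
    rw [hdiag.trace_mul, Complex.re_sum]
    exact Finset.sum_congr rfl fun i _ ↦ by simp [him i]
  have hle : (B * σ).trace.re ≤ 2 ^ (-c) := by
    calc (B * σ).trace.re ≤ ∑ i, 2 ^ (-c) * (σ i i).re := by
          rw [htrace]
          exact Finset.sum_le_sum fun i _ ↦ mul_le_mul_of_nonneg_right (hB i).2 (hre i)
      _ = 2 ^ (-c) := by rw [← Finset.mul_sum, hsum, mul_one]
  have hpos : 0 < (B * σ).trace.re := by
    obtain ⟨i, -, hi⟩ : ∃ i ∈ Finset.univ, 0 < (σ i i).re := by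
      by_contra! h
      linarith [Finset.sum_nonpos h]
    rw [htrace]
    exact Finset.sum_pos' (fun j _ ↦ mul_nonneg (hB j).1.le (hre j))
      ⟨i, Finset.mem_univ i, mul_pos (hB i).1 hi⟩
  rw [le_neg, Real.logb_le_iff_le_rpow one_lt_two hpos]
  exact hle

theorem incoherentMinLog_le_of_le_trace (hd : 1 ≤ d) {A ρ : Matrix (Fin d) (Fin d) ℂ}
    (hA : A.PosSemidef) (hA1 : (1 - A).PosSemidef) (hρ : ρ.PosSemidef) (hρtr : ρ.trace = 1)
    {c : ℝ} (hc : 0 < c) (hcA : c ≤ (A * ρ).trace.re) :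
    incoherentMinLog A ≤ -Real.logb 2 (c / d) := by
  have hd0 : (0 : ℝ) < d := by exact_mod_cast hd
  obtain ⟨i, -, hi⟩ : ∃ i ∈ Finset.univ, c / d ≤ (A i i).re := by
    refine Finset.exists_le_of_sum_le ⟨⟨0, hd⟩, Finset.mem_univ _⟩ ?_
    have h := hcA.trans (hA.trace_mul_re_le_trace hρ hρtr)
    simp only [trace, diag_apply, Complex.re_sum] at h
    simpa [mul_div_cancel₀ _ hd0.ne'] using h
  refine (incoherentMinLog_le hA hA1 (posSemidef_diagonal_single i) (trace_diagonal_single i)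
    (isDiag_diagonal _)).trans (neg_le_neg ?_)
  rw [trace_mul_diagonal_single]
  exact Real.logb_le_logb_of_le one_lt_two (by positivity) hi

theorem incoherentMinLog_le_CminSmooth (hd : 1 ≤ d) {ε : ℝ} (hε1 : ε < 1)
    {A ρ : Matrix (Fin d) (Fin d) ℂ} (hρ : ρ.PosSemidef) (hρtr : ρ.trace = 1)
    (hA : A.PosSemidef) (hA1 : (1 - A).PosSemidef) (hAρ : 1 - ε ≤ (A * ρ).trace.re) :
    incoherentMinLog A ≤ CminSmooth d ε ρ := by
  refine le_csSup ⟨-Real.logb 2 ((1 - ε) / d), ?_⟩ ⟨A, hA, hA1, hAρ, rfl⟩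
  rintro y ⟨A', hA', hA1', hAρ', rfl⟩
  exact incoherentMinLog_le_of_le_trace hd hA' hA1' hρ hρtr (sub_pos.mpr hε1) hAρ'

end Incoherent

/-- monotonicity of the smooth min-relative entropy of coherence
under maximally incoherent operations: `C^ε_min(E(ρ)) ≤ C^ε_min(ρ)`. -/
theorem stmt19 (d : ℕ) (hd : 1 ≤ d)
    (ρ : Matrix (Fin d) (Fin d) ℂ) (hρ : ρ.PosSemidef) (hρtr : ρ.trace = 1)
    (ε : ℝ) (hε0 : 0 < ε) (hε1 : ε < 1)
    (n : ℕ) (K : Fin n → Matrix (Fin d) (Fin d) ℂ)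
    (hK : ∑ j, (K j)ᴴ * K j = 1)
    (hMIO : ∀ σ : Matrix (Fin d) (Fin d) ℂ,
      σ.PosSemidef → σ.trace = 1 → σ.IsDiag →
        (∑ j, K j * σ * (K j)ᴴ).IsDiag) :
    CminSmooth d ε (∑ j, K j * ρ * (K j)ᴴ) ≤ CminSmooth d ε ρ := by
  refine csSup_le ⟨_, 1, .one, by simpa using PosSemidef.zero, ?_, rfl⟩ ?_
  · rw [trace_mul_sum_kraus]
    simp only [Matrix.mul_one, hK, Matrix.one_mul, hρtr, Complex.one_re]
    linarith
  rintro y ⟨A, hA, hA1, hAρ, rfl⟩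
  change incoherentMinLog A ≤ _
  rw [trace_mul_sum_kraus] at hAρ
  set B := ∑ j, (K j)ᴴ * A * K j with hBdef
  have hB : B.PosSemidef := posSemidef_sum _ fun j _ ↦ hA.conjTranspose_mul_mul_same (K j)
  have hB1 : (1 - B).PosSemidef := by
    have h : 1 - B = ∑ j, (K j)ᴴ * (1 - A) * K j := by
      simp only [Matrix.mul_sub, Matrix.sub_mul, Matrix.mul_one, Finset.sum_sub_distrib, hK, hBdef]
    rw [h]
    exact posSemidef_sum _ fun j _ ↦ hA1.conjTranspose_mul_mul_same (K j)
  have hBdiag : ∀ i, (B i i).re ≤ 2 ^ (-incoherentMinLog A) := fun i ↦ by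
    have hσ := posSemidef_diagonal_single i
    rw [← trace_mul_diagonal_single B i, hBdef, ← trace_mul_sum_kraus]
    refine trace_mul_re_le_rpow_of_isDiag hA hA1
      (posSemidef_sum _ fun j _ ↦ hσ.mul_mul_conjTranspose_same (K j)) ?_
      (hMIO _ hσ (trace_diagonal_single i) (isDiag_diagonal _))
    rw [← Matrix.one_mul (∑ j, _), trace_mul_sum_kraus]
    simp only [Matrix.mul_one, hK, Matrix.one_mul, trace_diagonal_single]
  obtain ⟨B', hB', hB1', hBB', hdiag⟩ := hB.exists_diag_pos_extension hB1 (by positivity)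
    (Real.rpow_le_one_of_one_le_of_nonpos one_le_two
      (neg_nonpos.mpr (incoherentMinLog_nonneg hA hA1))) hBdiag
  refine (le_incoherentMinLog hd hdiag).trans
    (incoherentMinLog_le_CminSmooth hd hε1 hρ hρtr hB' hB1' (hAρ.trans ?_))
  have h := hBB'.trace_mul_re_nonneg hρ
  rw [Matrix.sub_mul, trace_sub, Complex.sub_re] at h
  linarith
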